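/- Let γ be a CRF, n_1 ∈ N, 2^{n_j} ≤ γ_j(2^{n_1}) < 2^{n_j+1} for j = 2,…,d, and define f_{n̄_1}(x) := (D_{2^{n_1+1}}(x^1) − D_{2^{n_1}}(x^1)) · Π_{j=2}^d w_{2^{n_j}−1}(x^j) on G^d. Then the d-dimensional Walsh–Kaczmarz–Fourier coefficients of f_{n̄_1} are: f̂^κ_{n̄_1}(k) = 1 if 2^{n_1} ≤ k_1 ≤ 2^{n_1+1}−1 and k_j = 2^{n_j}−1 for all j = 2,…,d, and f̂^κ_{n̄_1}(k) = 0 otherwise. Moreover the martingale maximal function satisfies f*_{n̄_1} = |f_{n̄_1}| and, for 0 < p_0 ≤ 1, ‖f_{n̄_1}‖_{H_{p_0}^γ} = ‖D_{2^{n_1}}‖_{p_0} = 2^{(1−1/p_0)n_1}, so f_{n̄_1} ∈ H_{p_0}^γ(G^d). -/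

import Mathlib

open MeasureTheory Filter Finset ENNReal

noncomputable section

/-- The Walsh group `G`: countable product of copies of `ℤ/2ℤ`. -/
abbrev WG : Type := ℕ → ZMod 2

/-- The normalized Haar measure (= product of uniform coin-toss measures) on `G`. -/
def μW : Measure WG := Measure.addHaarMeasure ⊤

instance : (μW).Regular := by unfold μW; infer_instance

instance : IsFiniteMeasure μW := by
  constructor
  rw [← TopologicalSpace.PositiveCompacts.coe_top (α := WG)]
  exact IsCompact.measure_lt_top (⊤ : TopologicalSpace.PositiveCompacts WG).isCompact

/-- The product measure on `G^d`. -/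
def μD (d : ℕ) : Measure (Fin d → WG) := Measure.pi fun _ => μW

/-- The `k`-th Rademacher function. -/
def rad (k : ℕ) (x : WG) : ℝ := (-1 : ℝ) ^ (x k).val

/-- The Walsh–Paley function of index `n`. -/
def walsh (n : ℕ) (x : WG) : ℝ :=
  ∏ k ∈ Finset.range n.size, if n.testBit k then rad k x else 1

/-- The Walsh–Kaczmarz function of index `n`; `Nat.log 2 n` is the order `|n|`. -/
def kacz (n : ℕ) (x : WG) : ℝ :=
  if n = 0 then 1 else
    rad (Nat.log 2 n) x *
      (-1 : ℝ) ^ (∑ k ∈ Finset.range (Nat.log 2 n),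
        (if n.testBit k then 1 else 0) * (x (Nat.log 2 n - 1 - k)).val)

/-- The `d`-dimensional Walsh–Kaczmarz function. -/
def kaczD (d : ℕ) (m : Fin d → ℕ) (x : Fin d → WG) : ℝ := ∏ i, kacz (m i) (x i)

/-- Walsh–Paley Dirichlet kernel. -/
def dirW (n : ℕ) (x : WG) : ℝ := ∑ k ∈ Finset.range n, walsh k x

/-- Walsh–Kaczmarz Dirichlet kernel. -/
def dirK (n : ℕ) (x : WG) : ℝ := ∑ k ∈ Finset.range n, kacz k x

/-- `A_j^α = binom (j+α) j`. -/
def Abin (α : ℝ) (j : ℕ) : ℝ := ∏ i ∈ Finset.range j, (α + i + 1) / (i + 1)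

/-- One-dimensional Walsh–Paley `(C,α)` kernel. -/
def KW (α : ℝ) (n : ℕ) (x : WG) : ℝ :=
  (Abin α n)⁻¹ * ∑ k ∈ Finset.range (n + 1), Abin (α - 1) (n - k) * dirW k x

/-- One-dimensional Walsh–Kaczmarz `(C,α)` kernel. -/
def KK (α : ℝ) (n : ℕ) (x : WG) : ℝ :=
  (Abin α n)⁻¹ * ∑ k ∈ Finset.range (n + 1), Abin (α - 1) (n - k) * dirK k x

/-- The `m`-th Walsh–Kaczmarz–Fourier coefficient of `f : G^d → ℝ`. -/
def fCoeff (d : ℕ) (f : (Fin d → WG) → ℝ) (m : Fin d → ℕ) : ℝ :=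
  ∫ x, f x * kaczD d m x ∂ μD d

/-- Rectangular partial sum built from an abstract family `c` of Fourier coefficients. -/
def partialSumOf (d : ℕ) (c : (Fin d → ℕ) → ℝ) (k : Fin d → ℕ) (x : Fin d → WG) : ℝ :=
  ∑ m ∈ Fintype.piFinset (fun i => Finset.range (k i)), c m * kaczD d m x

/-- `(C,α)` (Cesàro) mean of order `n` built from coefficients `c`. -/
def cesaroOf (d : ℕ) (α : Fin d → ℝ) (c : (Fin d → ℕ) → ℝ) (n : Fin d → ℕ)
    (x : Fin d → WG) : ℝ :=
  (∏ i, Abin (α i) (n i))⁻¹ *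
    ∑ k ∈ Fintype.piFinset (fun i => Finset.range (n i + 1)),
      (∏ i, Abin (α i - 1) (n i - k i)) * partialSumOf d c k x

/-- A cone-like restriction function (CRF) family `γ = (γ_j)_{j ≠ 0}`. -/
structure IsCRF (d : ℕ) [NeZero d] (γ : Fin d → ℝ → ℝ) : Prop where
  strictMono : ∀ j : Fin d, j ≠ 0 → StrictMonoOn (γ j) (Set.Ici 1)
  contOn : ∀ j : Fin d, j ≠ 0 → ContinuousOn (γ j) (Set.Ici 1)
  one_le : ∀ j : Fin d, j ≠ 0 → ∀ x : ℝ, 1 ≤ x → 1 ≤ γ j x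
  map_one : ∀ j : Fin d, j ≠ 0 → γ j 1 = 1
  tendsto_atTop : ∀ j : Fin d, j ≠ 0 → Tendsto (γ j) atTop atTop
  reg : ∃ ζ : ℝ, 1 < ζ ∧ ∀ j : Fin d, j ≠ 0 → ∃ c₁ c₂ : ℝ, 1 < c₁ ∧ 1 < c₂ ∧
    ∀ x : ℝ, 1 ≤ x → c₁ * γ j x ≤ γ j (ζ * x) ∧ γ j (ζ * x) ≤ c₂ * γ j x

/-- The cone-like set `L` determined by `γ` and the parameters `β`. -/
def coneLike (d : ℕ) [NeZero d] (γ : Fin d → ℝ → ℝ) (β : Fin d → ℝ) : Set (Fin d → ℕ) :=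
  {n | ∀ j : Fin d, j ≠ 0 → (β j)⁻¹ * γ j (n 0) ≤ (n j : ℝ) ∧ (n j : ℝ) ≤ β j * γ j (n 0)}

/-- `bar γ n₁ = (n₁, n₂, …, n_d)` where `n_j = |γ_j(2^{n₁})|` is the order of `γ_j(2^{n₁})`,
i.e. `2^{n_j} ≤ γ_j(2^{n₁}) < 2^{n_j+1}`. -/
def bar (d : ℕ) [NeZero d] (γ : Fin d → ℝ → ℝ) (n₁ : ℕ) : Fin d → ℕ :=
  fun j => if j = 0 then n₁ else Nat.log 2 ⌊γ j ((2 : ℝ) ^ n₁)⌋₊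

/-- The cone-like restricted maximal operator `σ_L^{κ,α,*}` (built from coefficients `c`). -/
def cesaroMaximal (d : ℕ) [NeZero d] (α : Fin d → ℝ) (γ : Fin d → ℝ → ℝ) (β : Fin d → ℝ)
    (c : (Fin d → ℕ) → ℝ) (x : Fin d → WG) : ℝ≥0∞ :=
  ⨆ n ∈ coneLike d γ β, ENNReal.ofReal |cesaroOf d α c n x|

/-- `L^p`-"norm" (`0 < p < ∞`) of an `ℝ≥0∞`-valued function on `G^d`. -/
def lpNormE (d : ℕ) (p : ℝ) (g : (Fin d → WG) → ℝ≥0∞) : ℝ≥0∞ :=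
  (∫⁻ x, g x ^ p ∂ μD d) ^ (1 / p)

/-- The dyadic rectangle `I_{N}(y) = I_{N_1}(y^1) × ⋯ × I_{N_d}(y^d)`. -/
def rectAt (d : ℕ) (N : Fin d → ℕ) (y : Fin d → WG) : Set (Fin d → WG) :=
  {x | ∀ j : Fin d, ∀ i : ℕ, i < N j → x j i = y j i}

/-- The one-dimensional dyadic interval `I_N = I_N(0)`. -/
def rectW (N : ℕ) : Set WG := {x | ∀ i : ℕ, i < N → x i = 0}

/-- A one-parameter martingale with respect to the filtration
`(F_{bar γ n₁})_{n₁}` generated by the dyadic rectangles `I_{bar γ n₁}(y)`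
(measurability w.r.t. this atomic σ-algebra = being constant on its rectangles,
and the martingale property = equality of integrals over the rectangles). -/
structure ConeMartingale (d : ℕ) [NeZero d] (γ : Fin d → ℝ → ℝ) where
  F : ℕ → (Fin d → WG) → ℝ
  integrable : ∀ n₁, Integrable (F n₁) (μD d)
  adapted : ∀ n₁ (x y : Fin d → WG),
    (∀ j : Fin d, ∀ i : ℕ, i < bar d γ n₁ j → x j i = y j i) → F n₁ x = F n₁ y
  mart : ∀ n₁ m₁, n₁ ≤ m₁ → ∀ y,
    ∫ x in rectAt d (bar d γ n₁) y, F m₁ x ∂ μD d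
      = ∫ x in rectAt d (bar d γ n₁) y, F n₁ x ∂ μD d

/-- The Fourier coefficients of a martingale (the integrals `∫ f_k ψ_m` stabilize). -/
def martCoeff (d : ℕ) [NeZero d] (γ : Fin d → ℝ → ℝ) (f : ConeMartingale d γ) (m : Fin d → ℕ) : ℝ :=
  limUnder atTop (fun k => ∫ x, f.F k x * kaczD d m x ∂ μD d)

/-- The maximal function `f* = sup_{n₁} |f_{bar n₁}|` of a martingale. -/
def martMaximal (d : ℕ) [NeZero d] (γ : Fin d → ℝ → ℝ) (f : ConeMartingale d γ)
    (x : Fin d → WG) : ℝ≥0∞ :=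
  ⨆ n₁ : ℕ, ENNReal.ofReal |f.F n₁ x|

/-- The martingale Hardy space "norm" `‖f‖_{H_p^γ} = ‖f*‖_p`. -/
def hardyNorm (d : ℕ) [NeZero d] (γ : Fin d → ℝ → ℝ) (p : ℝ) (f : ConeMartingale d γ) : ℝ≥0∞ :=
  lpNormE d p (martMaximal d γ f)

/-- A `p`-atom supported on the rectangle `I_N(y)`. -/
structure IsPAtom (d : ℕ) (p : ℝ) (a : (Fin d → WG) → ℝ) (N : Fin d → ℕ)
    (y : Fin d → WG) : Prop where
  measurable : Measurable a
  support : ∀ x, x ∉ rectAt d N y → a x = 0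
  bound : ∀ x, |a x| ≤ ((μD d (rectAt d N y)).toReal) ^ (-(1 / p))
  zero : ∫ x, a x ∂ μD d = 0

/-- The conditional-expectation (dyadic average) of `f` at level `N`. -/
def avgAt (d : ℕ) (N : Fin d → ℕ) (f : (Fin d → WG) → ℝ) (x : Fin d → WG) : ℝ :=
  (2 : ℝ) ^ (∑ j, N j) * ∫ t in rectAt d N x, f t ∂ μD d

/-- `m` is the martingale generated by the integrable function `f`. -/
def inducedLevels (d : ℕ) [NeZero d] (γ : Fin d → ℝ → ℝ) (f : (Fin d → WG) → ℝ)
    (m : ConeMartingale d γ) : Prop :=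
  ∀ n₁ x, m.F n₁ x = avgAt d (bar d γ n₁) f x

/-- The martingale maximal function of (the martingale generated by) a function `f`,
`f* = sup_{n₁} |S_{2^{bar γ n₁}} f|`. -/
def funMaximal (d : ℕ) [NeZero d] (γ : Fin d → ℝ → ℝ) (f : (Fin d → WG) → ℝ)
    (x : Fin d → WG) : ℝ≥0∞ :=
  ⨆ n₁ : ℕ, ENNReal.ofReal |partialSumOf d (fCoeff d f) (fun j => 2 ^ bar d γ n₁ j) x|

/-- The Hardy norm `‖f‖_{H_p^γ}` of (the martingale generated by) a function `f`. -/
def funHardyNorm (d : ℕ) [NeZero d] (γ : Fin d → ℝ → ℝ) (p : ℝ) (f : (Fin d → WG) → ℝ) : ℝ≥0∞ :=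
  lpNormE d p (funMaximal d γ f)

/-- Skvortsov's bit-reversal transformation `τ_A`. -/
def tau (A : ℕ) (x : WG) : WG := fun i => if i < A then x (A - 1 - i) else x i

end

noncomputable section

/-- The counterexample function
`f_{n̄₁}(x) = (D_{2^{n₁+1}}(x¹) - D_{2^{n₁}}(x¹)) ∏_{j≠0} w_{2^{n_j}-1}(x^j)`,
where `n_j = bar γ n₁ j` is the order of `γ_j(2^{n₁})`. -/
def counterF (d : ℕ) [NeZero d] (γ : Fin d → ℝ → ℝ) (n₁ : ℕ) (x : Fin d → WG) : ℝ :=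
  (dirW (2 ^ (n₁ + 1)) (x 0) - dirW (2 ^ n₁) (x 0)) *
    ∏ j ∈ Finset.univ.erase 0, walsh (2 ^ (bar d γ n₁ j) - 1) (x j)

lemma rad_add (k : ℕ) (x y : WG) : rad k (x + y) = rad k x * rad k y := by
  have h : ∀ a b : ZMod 2, (-1 : ℝ) ^ (a + b).val = (-1) ^ a.val * (-1) ^ b.val := by
    intro a b
    rw [← pow_add, neg_one_pow_eq_pow_mod_two (a.val + b.val), ZMod.val_add]
  exact h (x k) (y k)

lemma abs_rad (k : ℕ) (x : WG) : |rad k x| = 1 := by simp [rad]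

lemma measurable_rad (k : ℕ) : Measurable (rad k) := by
  have h : Measurable fun a : ZMod 2 => (-1 : ℝ) ^ a.val := measurable_of_countable _
  exact h.comp (measurable_pi_apply k)

lemma rad_single_self (k : ℕ) : rad k (Pi.single k 1) = -1 := by
  simp [rad, ZMod.val_one]

lemma rad_single_of_ne {k i : ℕ} (h : k ≠ i) : rad k (Pi.single i 1) = 1 := by
  simp [rad, Pi.single_eq_of_ne h]

lemma kacz_eq_prod {n : ℕ} (hn : n ≠ 0) (x : WG) :
    kacz n x = rad (Nat.log 2 n) x *
      ∏ k ∈ Finset.range (Nat.log 2 n),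
        if n.testBit k then rad (Nat.log 2 n - 1 - k) x else 1 := by
  rw [kacz, if_neg hn, ← Finset.prod_pow_eq_pow_sum]
  congr 1
  refine Finset.prod_congr rfl fun k _ => ?_
  split_ifs <;> simp [rad]

lemma kacz_zero (x : WG) : kacz 0 x = 1 := by simp [kacz]

lemma kacz_add (n : ℕ) (x y : WG) : kacz n (x + y) = kacz n x * kacz n y := by
  rcases eq_or_ne n 0 with rfl | hn
  · simp [kacz_zero]
  · rw [kacz_eq_prod hn, kacz_eq_prod hn, kacz_eq_prod hn, rad_add, mul_mul_mul_comm,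
      ← Finset.prod_mul_distrib]
    congr 1
    refine Finset.prod_congr rfl fun k _ => ?_
    split_ifs <;> simp [rad_add]

lemma abs_kacz (n : ℕ) (x : WG) : |kacz n x| = 1 := by
  rcases eq_or_ne n 0 with rfl | hn
  · simp [kacz_zero]
  · rw [kacz, if_neg hn, abs_mul, abs_rad, abs_neg_one_pow, one_mul]

lemma measurable_kacz (n : ℕ) : Measurable (kacz n) := by
  rcases eq_or_ne n 0 with rfl | hn
  · simp only [funext kacz_zero, measurable_const]
  · rw [funext (kacz_eq_prod hn)]
    refine (measurable_rad _).mul (Finset.measurable_fun_prod _ fun k _ => ?_)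
    split_ifs
    exacts [measurable_rad _, measurable_const]

lemma kacz_single_log {n : ℕ} (hn : n ≠ 0) : kacz n (Pi.single (Nat.log 2 n) 1) = -1 := by
  rw [kacz_eq_prod hn, rad_single_self, Finset.prod_eq_one, mul_one]
  intro k hk
  rw [Finset.mem_range] at hk
  rw [rad_single_of_ne (by omega), ite_self]

lemma kacz_single_of_log_lt {n i : ℕ} (h : Nat.log 2 n < i) : kacz n (Pi.single i 1) = 1 := by
  rcases eq_or_ne n 0 with rfl | hn
  · exact kacz_zero _
  rw [kacz_eq_prod hn, rad_single_of_ne h.ne, Finset.prod_eq_one, mul_one]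
  intro k hk
  rw [Finset.mem_range] at hk
  rw [rad_single_of_ne (by omega), ite_self]

lemma kacz_single_bit {n k : ℕ} (h : k < Nat.log 2 n) :
    kacz n (Pi.single (Nat.log 2 n - 1 - k) 1) = if n.testBit k then -1 else 1 := by
  have hn : n ≠ 0 := by rintro rfl; simp at h
  rw [kacz_eq_prod hn, rad_single_of_ne (by omega), one_mul,
    Finset.prod_eq_single_of_mem k (Finset.mem_range.2 h), rad_single_self]
  intro i hi hik
  rw [Finset.mem_range] at hi
  rw [rad_single_of_ne (by omega), ite_self]

lemma testBit_log {n : ℕ} (hn : n ≠ 0) : n.testBit (Nat.log 2 n) = true := by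
  rw [Nat.testBit_eq_decide_div_mod_eq, decide_eq_true_iff]
  have h1 := Nat.pow_log_le_self 2 hn
  have h2 := Nat.lt_pow_succ_log_self (b := 2) (by norm_num) n
  have : n / 2 ^ Nat.log 2 n = 1 := by
    apply Nat.div_eq_of_lt_le <;> rw [pow_succ] at * <;> omega
  rw [this]

lemma exists_kacz_ne {m n : ℕ} (h : m ≠ n) : ∃ y, kacz m y ≠ kacz n y := by
  wlog hl : Nat.log 2 m ≤ Nat.log 2 n generalizing m n
  · obtain ⟨y, hy⟩ := this h.symm (le_of_not_ge hl)
    exact ⟨y, hy.symm⟩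
  by_cases hm : m = 0
  · subst hm
    refine ⟨Pi.single (Nat.log 2 n) 1, ?_⟩
    rw [kacz_zero, kacz_single_log h.symm]
    norm_num
  by_cases hn : n = 0
  · subst hn
    refine ⟨Pi.single (Nat.log 2 m) 1, ?_⟩
    rw [kacz_zero, kacz_single_log h]
    norm_num
  rcases hl.lt_or_eq with hlt | heq
  · refine ⟨Pi.single (Nat.log 2 n) 1, ?_⟩
    rw [kacz_single_of_log_lt hlt, kacz_single_log hn]
    norm_num
  · obtain ⟨k, hk⟩ : ∃ k, m.testBit k ≠ n.testBit k := by
      by_contra! hc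
      exact h (Nat.eq_of_testBit_eq hc)
    have hkl : k < Nat.log 2 n := by
      rcases lt_trichotomy k (Nat.log 2 n) with hlt | rfl | hgt
      · exact hlt
      · rw [testBit_log hn, ← heq, testBit_log hm] at hk
        exact absurd rfl hk
      · rw [Nat.testBit_lt_two_pow, Nat.testBit_lt_two_pow] at hk
        · exact absurd rfl hk
        · exact Nat.lt_pow_of_log_lt (by norm_num) hgt
        · exact Nat.lt_pow_of_log_lt (by norm_num) (heq ▸ hgt)
    refine ⟨Pi.single (Nat.log 2 n - 1 - k) 1, ?_⟩
    rw [kacz_single_bit hkl, ← heq, kacz_single_bit (heq ▸ hkl)]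
    cases hm' : m.testBit k <;> cases hn' : n.testBit k <;> simp_all <;> norm_num

instance : IsProbabilityMeasure μW := by
  constructor
  rw [μW, ← TopologicalSpace.PositiveCompacts.coe_top (α := WG)]
  exact Measure.addHaarMeasure_self

instance : (μW).IsAddHaarMeasure := by unfold μW; infer_instance

instance (d : ℕ) : IsProbabilityMeasure (μD d) := by unfold μD; infer_instance

lemma integral_kacz_mul_kacz (m n : ℕ) :
    ∫ x, kacz m x * kacz n x ∂μW = if m = n then 1 else 0 := by
  split_ifs with h
  · subst h
    have : ∀ x, kacz m x * kacz m x = 1 := fun x => by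
      rw [← abs_mul_abs_self, abs_kacz, one_mul]
    simp [this]
  · obtain ⟨y, hy⟩ := exists_kacz_ne h
    have hneg : kacz m y * kacz n y = -1 := by
      rcases eq_or_eq_neg_of_abs_eq (abs_kacz m y) with h1 | h1 <;>
      rcases eq_or_eq_neg_of_abs_eq (abs_kacz n y) with h2 | h2 <;>
      rw [h1, h2] at hy ⊢ <;> first | exact absurd rfl hy | norm_num
    have h1 := integral_add_right_eq_self (μ := μW) (fun x => kacz m x * kacz n x) y
    have h2 : ∀ x, kacz m (x + y) * kacz n (x + y) = -(kacz m x * kacz n x) := fun x => by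
      rw [kacz_add, kacz_add, mul_mul_mul_comm, hneg, mul_neg_one]
    simp only [h2, integral_neg] at h1
    linarith

lemma sum_prod_testBit (n : ℕ) (a : ℕ → ℝ) :
    ∑ k ∈ Finset.range (2 ^ n), ∏ i ∈ Finset.range n, (if k.testBit i then a i else 1)
      = ∏ i ∈ Finset.range n, (1 + a i) := by
  induction n with
  | zero => simp
  | succ n ih =>
    rw [pow_succ, mul_two, Finset.sum_range_add, Finset.prod_range_succ, ← ih, mul_add, mul_one,
      Finset.sum_mul]
    congr 1
    · refine Finset.sum_congr rfl fun k hk => ?_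
      rw [Finset.prod_range_succ, Nat.testBit_lt_two_pow (Finset.mem_range.1 hk)]
      simp
    · refine Finset.sum_congr rfl fun k hk => ?_
      rw [Finset.prod_range_succ, Nat.testBit_two_pow_add_eq,
        Nat.testBit_lt_two_pow (Finset.mem_range.1 hk)]
      simp only [Bool.not_false, if_true]
      congr 1
      refine Finset.prod_congr rfl fun i hi => ?_
      rw [Nat.testBit_two_pow_add_gt (Finset.mem_range.1 hi)]

lemma walsh_eq_prod {n k : ℕ} (hk : k < 2 ^ n) (x : WG) :
    walsh k x = ∏ i ∈ Finset.range n, if k.testBit i then rad i x else 1 := by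
  refine Finset.prod_subset (Finset.range_subset_range.2 (Nat.size_le.2 hk)) fun i _ hi => ?_
  rw [Finset.mem_range, not_lt] at hi
  rw [Nat.testBit_lt_two_pow (Nat.size_le.1 hi)]
  simp

lemma dirW_two_pow (n : ℕ) (x : WG) :
    dirW (2 ^ n) x = ∏ i ∈ Finset.range n, (1 + rad i x) := by
  rw [← sum_prod_testBit, dirW]
  exact Finset.sum_congr rfl fun k hk => walsh_eq_prod (Finset.mem_range.1 hk) x

lemma log_two_pow_add {n k : ℕ} (hk : k < 2 ^ n) : Nat.log 2 (2 ^ n + k) = n := by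
  refine Nat.log_eq_of_pow_le_of_lt_pow (by omega) ?_
  rw [pow_succ]
  omega

lemma kacz_two_pow_add {n k : ℕ} (hk : k < 2 ^ n) (x : WG) :
    kacz (2 ^ n + k) x =
      rad n x * ∏ i ∈ Finset.range n, if k.testBit i then rad (n - 1 - i) x else 1 := by
  have : 0 < 2 ^ n := by positivity
  rw [kacz_eq_prod (by omega), log_two_pow_add hk]
  congr 1
  refine Finset.prod_congr rfl fun i hi => ?_
  rw [Nat.testBit_two_pow_add_gt (Finset.mem_range.1 hi)]

lemma dirW_two_pow_succ_sub (n : ℕ) (x : WG) :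
    dirW (2 ^ (n + 1)) x - dirW (2 ^ n) x = rad n x * dirW (2 ^ n) x := by
  rw [dirW_two_pow, dirW_two_pow, Finset.prod_range_succ]
  ring

lemma sum_kacz_block (n : ℕ) (x : WG) :
    ∑ k ∈ Finset.range (2 ^ n), kacz (2 ^ n + k) x
      = dirW (2 ^ (n + 1)) x - dirW (2 ^ n) x := by
  rw [dirW_two_pow_succ_sub, dirW_two_pow, ← Finset.prod_range_reflect, ← sum_prod_testBit,
    Finset.mul_sum]
  exact Finset.sum_congr rfl fun k hk => kacz_two_pow_add (Finset.mem_range.1 hk) x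

lemma walsh_two_pow_sub_one (n : ℕ) (x : WG) :
    walsh (2 ^ n - 1) x = ∏ i ∈ Finset.range n, rad i x := by
  rw [walsh_eq_prod (n := n) (Nat.sub_lt (by positivity) one_pos)]
  refine Finset.prod_congr rfl fun i hi => ?_
  rw [Nat.testBit_two_pow_sub_one]
  simp [Finset.mem_range.1 hi]

lemma kacz_two_pow_sub_one (n : ℕ) (x : WG) : kacz (2 ^ n - 1) x = walsh (2 ^ n - 1) x := by
  rw [walsh_two_pow_sub_one]
  cases n with
  | zero => simp [kacz_zero]
  | succ n =>
    have h0 : 0 < 2 ^ n := by positivity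
    have h : 2 ^ (n + 1) - 1 = 2 ^ n + (2 ^ n - 1) := by rw [pow_succ]; omega
    rw [h, kacz_two_pow_add (by omega), Finset.prod_range_succ, mul_comm,
      ← Finset.prod_range_reflect (fun i => rad i x)]
    congr 1
    refine Finset.prod_congr rfl fun i hi => ?_
    rw [Nat.testBit_two_pow_sub_one]
    simp [Finset.mem_range.1 hi]

/-- The multi-index with first entry `2^{N_0} + a` and entries `2^{N_j} - 1` for `j ≠ 0`. -/
def blockIndex (d : ℕ) [NeZero d] (N : Fin d → ℕ) (a : ℕ) : Fin d → ℕ :=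
  fun j => if j = 0 then 2 ^ N 0 + a else 2 ^ N j - 1

lemma counterF_eq_sum (d : ℕ) [NeZero d] (γ : Fin d → ℝ → ℝ) (n : ℕ) (x : Fin d → WG) :
    counterF d γ n x
      = ∑ a ∈ Finset.range (2 ^ n), kaczD d (blockIndex d (bar d γ n) a) x := by
  rw [counterF, ← sum_kacz_block, Finset.sum_mul]
  refine Finset.sum_congr rfl fun a _ => ?_
  rw [kaczD, ← Finset.mul_prod_erase _ _ (Finset.mem_univ 0)]
  have h0 : blockIndex d (bar d γ n) a 0 = 2 ^ n + a := by simp [blockIndex, bar]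
  rw [h0]
  refine congrArg _ (Finset.prod_congr rfl fun j hj => ?_)
  rw [blockIndex, if_neg (Finset.ne_of_mem_erase hj), kacz_two_pow_sub_one]

lemma abs_kaczD (d : ℕ) (m : Fin d → ℕ) (x : Fin d → WG) : |kaczD d m x| = 1 := by
  simp [kaczD, Finset.abs_prod, abs_kacz]

lemma measurable_kaczD (d : ℕ) (m : Fin d → ℕ) : Measurable (kaczD d m) :=
  Finset.measurable_fun_prod _ fun i _ => (measurable_kacz (m i)).comp (measurable_pi_apply i)

lemma integrable_kaczD_mul_kaczD (d : ℕ) (m n : Fin d → ℕ) :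
    Integrable (fun x => kaczD d m x * kaczD d n x) (μD d) :=
  .of_bound ((measurable_kaczD d m).mul (measurable_kaczD d n)).aestronglyMeasurable 1
    (.of_forall fun x => by rw [Real.norm_eq_abs, abs_mul, abs_kaczD, abs_kaczD, one_mul])

lemma integral_kaczD_mul_kaczD (d : ℕ) (m n : Fin d → ℕ) :
    ∫ x, kaczD d m x * kaczD d n x ∂μD d = if m = n then 1 else 0 := by
  simp only [kaczD, ← Finset.prod_mul_distrib, μD]
  rw [integral_fintype_prod_eq_prod (fun i t => kacz (m i) t * kacz (n i) t)]
  simp only [integral_kacz_mul_kacz, Finset.prod_ite_zero, Finset.prod_const_one,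
    Finset.mem_univ, true_imp_iff, funext_iff]

lemma fCoeff_counterF (d : ℕ) [NeZero d] (γ : Fin d → ℝ → ℝ) (n : ℕ) (k : Fin d → ℕ) :
    fCoeff d (counterF d γ n) k
      = ∑ a ∈ Finset.range (2 ^ n), if blockIndex d (bar d γ n) a = k then 1 else 0 := by
  simp only [fCoeff, counterF_eq_sum, Finset.sum_mul]
  rw [integral_finsetSum _ fun a _ => integrable_kaczD_mul_kaczD d _ _]
  simp only [integral_kaczD_mul_kaczD]

lemma partialSumOf_counterF (d : ℕ) [NeZero d] (γ : Fin d → ℝ → ℝ) (n : ℕ) (K : Fin d → ℕ)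
    (x : Fin d → WG) :
    partialSumOf d (fCoeff d (counterF d γ n)) K x
      = ∑ a ∈ Finset.range (2 ^ n), if ∀ i, blockIndex d (bar d γ n) a i < K i
          then kaczD d (blockIndex d (bar d γ n) a) x else 0 := by
  simp only [partialSumOf, fCoeff_counterF, Finset.sum_mul, ite_mul, one_mul, zero_mul]
  rw [Finset.sum_comm]
  simp only [Finset.sum_ite_eq, Fintype.mem_piFinset, Finset.mem_range]

lemma IsCRF.bar_mono {d : ℕ} [NeZero d] {γ : Fin d → ℝ → ℝ} (hγ : IsCRF d γ) :
    Monotone (bar d γ) := by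
  intro m n hmn j
  by_cases hj : j = 0
  · simpa [bar, hj] using hmn
  · simp only [bar, if_neg hj]
    refine Nat.log_mono_right (Nat.floor_mono ((hγ.strictMono j hj).monotoneOn ?_ ?_ ?_))
    · exact Set.mem_Ici.2 (one_le_pow₀ one_le_two)
    · exact Set.mem_Ici.2 (one_le_pow₀ one_le_two)
    · exact pow_le_pow_right₀ one_le_two hmn

lemma IsCRF.partialSumOf_bar {d : ℕ} [NeZero d] {γ : Fin d → ℝ → ℝ} (hγ : IsCRF d γ)
    (n M : ℕ) (x : Fin d → WG) :
    partialSumOf d (fCoeff d (counterF d γ n)) (fun j => 2 ^ bar d γ M j) x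
      = if n < M then counterF d γ n x else 0 := by
  rw [partialSumOf_counterF]
  split_ifs with h
  · rw [counterF_eq_sum]
    refine Finset.sum_congr rfl fun a ha => if_pos fun i => ?_
    rw [Finset.mem_range] at ha
    by_cases hi : i = 0
    · have h1 : 2 ^ (n + 1) ≤ 2 ^ M := Nat.pow_le_pow_right two_pos h
      simp only [blockIndex, bar, hi, if_true]
      rw [pow_succ] at h1
      omega
    · simp only [blockIndex, if_neg hi]
      have h1 : 2 ^ bar d γ n i ≤ 2 ^ bar d γ M i :=
        Nat.pow_le_pow_right two_pos (hγ.bar_mono h.le i)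
      have h2 : 0 < 2 ^ bar d γ n i := by positivity
      omega
  · refine Finset.sum_eq_zero fun a _ => if_neg fun hc => ?_
    have h0 := hc 0
    have h1 : 2 ^ M ≤ 2 ^ n := Nat.pow_le_pow_right two_pos (not_lt.1 h)
    simp only [blockIndex, bar, if_true] at h0
    omega

lemma IsCRF.funMaximal_counterF {d : ℕ} [NeZero d] {γ : Fin d → ℝ → ℝ} (hγ : IsCRF d γ)
    (n : ℕ) (x : Fin d → WG) :
    funMaximal d γ (counterF d γ n) x = ENNReal.ofReal |counterF d γ n x| := by
  simp only [funMaximal, hγ.partialSumOf_bar]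
  refine le_antisymm (iSup_le fun M => ?_) (le_iSup_of_le (n + 1) ?_)
  · split_ifs <;> simp
  · simp

lemma abs_counterF (d : ℕ) [NeZero d] (γ : Fin d → ℝ → ℝ) (n : ℕ) (x : Fin d → WG) :
    |counterF d γ n x| = |dirW (2 ^ n) (x 0)| := by
  rw [counterF, dirW_two_pow_succ_sub, abs_mul, abs_mul, abs_rad, one_mul, Finset.abs_prod,
    Finset.prod_eq_one, mul_one]
  intro j _
  rw [← kacz_two_pow_sub_one, abs_kacz]

lemma measurable_dirW_two_pow (n : ℕ) : Measurable (dirW (2 ^ n)) := by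
  rw [funext (dirW_two_pow n)]
  exact Finset.measurable_fun_prod _ fun i _ => (measurable_rad i).const_add 1

lemma dirW_two_pow_eq_indicator (n : ℕ) :
    dirW (2 ^ n) = (rectW n).indicator fun _ => (2 : ℝ) ^ n := by
  ext x
  rw [dirW_two_pow]
  by_cases hx : x ∈ rectW n
  · rw [Set.indicator_of_mem hx, Finset.prod_eq_pow_card (b := 2), Finset.card_range]
    intro i hi
    rw [rad, hx i (Finset.mem_range.1 hi)]
    norm_num
  · rw [Set.indicator_of_notMem hx]
    simp only [rectW, Set.mem_ofPred_eq, not_forall] at hx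
    obtain ⟨i, hi, hxi⟩ := hx
    refine Finset.prod_eq_zero (Finset.mem_range.2 hi) ?_
    have h : ∀ a : ZMod 2, a ≠ 0 → a.val = 1 := by decide
    rw [rad, h _ hxi]
    norm_num

lemma measurableSet_rectW (n : ℕ) : MeasurableSet (rectW n) := by
  simp only [rectW, Set.ofPred_forall]
  exact .iInter fun i => .iInter fun _ => measurableSet_eq_fun (measurable_pi_apply i)
    measurable_const

lemma integrable_kacz (n : ℕ) : Integrable (kacz n) μW :=
  .of_bound (measurable_kacz n).aestronglyMeasurable 1
    (.of_forall fun x => by rw [Real.norm_eq_abs, abs_kacz])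

lemma integrable_dirW_two_pow (n : ℕ) : Integrable (dirW (2 ^ n)) μW := by
  rw [dirW_two_pow_eq_indicator]
  exact (integrable_const _).indicator (measurableSet_rectW n)

lemma integral_dirW_two_pow (n : ℕ) : ∫ x, dirW (2 ^ n) x ∂μW = 1 := by
  induction n with
  | zero => simp only [dirW_two_pow, Finset.range_zero, Finset.prod_empty, integral_const,
      probReal_univ, smul_eq_mul, mul_one]
  | succ n ih =>
    have h : ∫ x, (dirW (2 ^ (n + 1)) x - dirW (2 ^ n) x) ∂μW = 0 := by
      simp only [← sum_kacz_block]
      rw [integral_finsetSum _ fun a _ => integrable_kacz _]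
      refine Finset.sum_eq_zero fun a _ => ?_
      have := integral_kacz_mul_kacz (2 ^ n + a) 0
      simpa [kacz_zero] using this
    rw [integral_sub (integrable_dirW_two_pow _) (integrable_dirW_two_pow _), ih] at h
    linarith

lemma measure_rectW (n : ℕ) : μW (rectW n) = ENNReal.ofReal ((2 : ℝ) ^ (-(n : ℝ))) := by
  have h := integral_dirW_two_pow n
  rw [dirW_two_pow_eq_indicator, integral_indicator_const _ (measurableSet_rectW n),
    smul_eq_mul] at h
  rw [← ofReal_measureReal, Real.rpow_neg two_pos.le, Real.rpow_natCast]
  exact congrArg _ (eq_inv_of_mul_eq_one_left h)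

lemma lpNorm_dirW_two_pow (n : ℕ) {p : ℝ} (hp : 0 < p) :
    (∫⁻ t, (ENNReal.ofReal |dirW (2 ^ n) t|) ^ p ∂μW) ^ (1 / p)
      = ENNReal.ofReal ((2 : ℝ) ^ ((1 - 1 / p) * n)) := by
  have h : ∀ t, (ENNReal.ofReal |dirW (2 ^ n) t|) ^ p
      = (rectW n).indicator (fun _ => ENNReal.ofReal ((2 : ℝ) ^ (n * p))) t := by
    intro t
    rw [dirW_two_pow_eq_indicator]
    by_cases ht : t ∈ rectW n
    · rw [Set.indicator_of_mem ht, Set.indicator_of_mem ht, abs_of_nonneg (by positivity),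
        ENNReal.ofReal_rpow_of_nonneg (by positivity) hp.le, Real.rpow_mul two_pos.le,
        Real.rpow_natCast]
    · rw [Set.indicator_of_notMem ht, Set.indicator_of_notMem ht, abs_zero, ENNReal.ofReal_zero,
        ENNReal.zero_rpow_of_pos hp]
  simp only [h]
  rw [lintegral_indicator_const (measurableSet_rectW n), measure_rectW,
    ← ENNReal.ofReal_mul (by positivity), ← Real.rpow_add two_pos,
    ENNReal.ofReal_rpow_of_nonneg (by positivity) (by positivity), ← Real.rpow_mul two_pos.le]
  congr 2
  field_simp
  ring

lemma IsCRF.funHardyNorm_counterF {d : ℕ} [NeZero d] {γ : Fin d → ℝ → ℝ} (hγ : IsCRF d γ)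
    (n : ℕ) (p : ℝ) :
    funHardyNorm d γ p (counterF d γ n)
      = (∫⁻ t, (ENNReal.ofReal |dirW (2 ^ n) t|) ^ p ∂μW) ^ (1 / p) := by
  simp only [funHardyNorm, lpNormE, hγ.funMaximal_counterF, abs_counterF, μD]
  congr 1
  refine (measurePreserving_eval (fun _ : Fin d => μW) 0).lintegral_comp
    (f := fun t => (ENNReal.ofReal |dirW (2 ^ n) t|) ^ p) ?_
  exact (measurable_dirW_two_pow n).abs.ennreal_ofReal.pow_const p

open Classical in
/-- the Walsh–Kaczmarz–Fourier coefficients of the counterexample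
`f_{n̄₁}` are `1` exactly when `2^{n₁} ≤ k₁ ≤ 2^{n₁+1}-1` and `k_j = 2^{n_j}-1` (`j ≠ 0`),
and `0` otherwise; its martingale maximal function is `|f_{n̄₁}|`; and
`‖f_{n̄₁}‖_{H_{p₀}^γ} = ‖D_{2^{n₁}}‖_{p₀} = 2^{(1-1/p₀)n₁}`, so `f_{n̄₁} ∈ H_{p₀}^γ`. -/
theorem counterexample_properties
    (d : ℕ) (γ : Fin (d + 1) → ℝ → ℝ) (hγ : IsCRF (d + 1) γ)
    (p₀ : ℝ) (hp₀ : 0 < p₀) (hp₀1 : p₀ ≤ 1) (n₁ : ℕ) :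
    (∀ k : Fin (d + 1) → ℕ,
      fCoeff (d + 1) (counterF (d + 1) γ n₁) k =
        if 2 ^ n₁ ≤ k 0 ∧ k 0 ≤ 2 ^ (n₁ + 1) - 1 ∧
            (∀ j : Fin (d + 1), j ≠ 0 → k j = 2 ^ (bar (d + 1) γ n₁ j) - 1)
        then 1 else 0) ∧
    (∀ x, funMaximal (d + 1) γ (counterF (d + 1) γ n₁) x
        = ENNReal.ofReal |counterF (d + 1) γ n₁ x|) ∧
    funHardyNorm (d + 1) γ p₀ (counterF (d + 1) γ n₁)
      = (∫⁻ t, (ENNReal.ofReal |dirW (2 ^ n₁) t|) ^ p₀ ∂ μW) ^ (1 / p₀) ∧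
    funHardyNorm (d + 1) γ p₀ (counterF (d + 1) γ n₁)
      = ENNReal.ofReal ((2 : ℝ) ^ ((1 - 1 / p₀) * n₁)) := by
  refine ⟨fun k => ?_, hγ.funMaximal_counterF n₁, hγ.funHardyNorm_counterF n₁ p₀, ?_⟩
  · have h0 : 2 ^ (n₁ + 1) = 2 ^ n₁ + 2 ^ n₁ := by ring
    have hpos : 0 < 2 ^ n₁ := by positivity
    rw [fCoeff_counterF]
    split_ifs with h
    · obtain ⟨h1, h2, h3⟩ := h
      rw [Finset.sum_eq_single_of_mem (k 0 - 2 ^ n₁) (Finset.mem_range.2 (by omega))]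
      · refine if_pos (funext fun j => ?_)
        by_cases hj : j = 0
        · subst hj
          simp only [blockIndex, bar, if_true]
          omega
        · rw [blockIndex, if_neg hj, h3 j hj]
      · refine fun a _ ha => if_neg fun hc => ha ?_
        rw [← hc]
        simp [blockIndex, bar]
    · refine Finset.sum_eq_zero fun a ha => if_neg fun hc => h ?_
      rw [Finset.mem_range] at ha
      subst hc
      refine ⟨?_, ?_, fun j hj => by rw [blockIndex, if_neg hj]⟩ <;>
        simp only [blockIndex, bar, if_true] <;> omega
  · rw [hγ.funHardyNorm_counterF, lpNorm_dirW_two_pow n₁ hp₀]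

end
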